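/- Simulation of call-by-value algebraic equality by call-by-name algebraic equality: let S_ℓ be a fragment of the call-by-value calculus and S_a a fragment of the call-by-name calculus such that for every M ∈ S_ℓ, (M~) λx.x ∈ S_a. Then for every term M ∈ S_ℓ and every value V, if M (=ℓ∪β^{S_ℓ})* V, then (M~) λx.x (=a∪β^{S_a})* Ψ(V). (Here R* denotes the reflexive-transitive closure of a relation R.) -/

import Mathlib

namespace AlgLam

/-- Terms of the algebraic λ-calculus over a ring of scalars `R`,
    in de Bruijn representation. -/
inductive Term (R : Type u) : Type u
  | var : ℕ → Term R
  | lam : Term R → Term R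
  | app : Term R → Term R → Term R
  | zero : Term R
  | smul : R → Term R → Term R
  | add : Term R → Term R → Term R

namespace Term

variable {R : Type u}

/-- De Bruijn lifting: shift the free indices `≥ d` up by one. -/
def lift (d : ℕ) : Term R → Term R
  | var n => if n < d then var n else var (n + 1)
  | lam M => lam (lift (d + 1) M)
  | app M N => app (lift d M) (lift d N)
  | zero => zero
  | smul a M => smul a (lift d M)
  | add M N => add (lift d M) (lift d N)

/-- Capture-avoiding substitution of `N` for the free de Bruijn index `d`. -/
def subst (d : ℕ) (N : Term R) : Term R → Term R
  | var n => if n < d then var n else if n = d then N else var (n - 1)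
  | lam M => lam (subst (d + 1) (lift 0 N) M)
  | app M L => app (subst d N M) (subst d N L)
  | zero => zero
  | smul a M => smul a (subst d N M)
  | add M L => add (subst d N M) (subst d N L)

/-- Base terms: variables and λ-abstractions. -/
inductive IsBase : Term R → Prop
  | var (n : ℕ) : IsBase (var n)
  | lam (M : Term R) : IsBase (lam M)

/-- Values: `0`, base terms, scalar multiples of values, sums of values. -/
inductive IsValue : Term R → Prop
  | zero : IsValue zero
  | base {B : Term R} : IsBase B → IsValue B
  | smul (a : R) {V : Term R} : IsValue V → IsValue (smul a V)
  | add {V W : Term R} : IsValue V → IsValue W → IsValue (add V W)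

/-- `ClosedUnder d M` : every free index of `M` is `< d`. -/
def ClosedUnder : ℕ → Term R → Prop
  | d, var n => n < d
  | d, lam M => ClosedUnder (d + 1) M
  | d, app M N => ClosedUnder d M ∧ ClosedUnder d N
  | _, zero => True
  | d, smul _ M => ClosedUnder d M
  | d, add M N => ClosedUnder d M ∧ ClosedUnder d N

/-- A closed term (a program). -/
def Closed (M : Term R) : Prop := ClosedUnder 0 M

section Rules

variable [CommRing R]

/-- The rewrite relation `→a` of the call-by-name algebraic λ-calculus:
    ring rules and call-by-name application rules, closed under the ξ contexts. -/
inductive StepA : Term R → Term R → Prop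
  -- ring rules
  | assocL (M N L : Term R) : StepA (add M (add N L)) (add (add M N) L)
  | assocR (M N L : Term R) : StepA (add (add M N) L) (add M (add N L))
  | comm (M N : Term R) : StepA (add M N) (add N M)
  | factor (a b : R) (M : Term R) : StepA (add (smul a M) (smul b M)) (smul (a + b) M)
  | factor1 (a : R) (M : Term R) : StepA (add (smul a M) M) (smul (a + 1) M)
  | factor11 (M : Term R) : StepA (add M M) (smul (1 + 1) M)
  | mulMul (a b : R) (M : Term R) : StepA (smul a (smul b M)) (smul (a * b) M)
  | mulDist (a : R) (M N : Term R) : StepA (smul a (add M N)) (add (smul a M) (smul a N))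
  | oneSmul (M : Term R) : StepA (smul 1 M) M
  | zeroSmul (M : Term R) : StepA (smul 0 M) zero
  | smulZero (a : R) : StepA (smul a zero) zero
  | zeroAdd (M : Term R) : StepA (add zero M) M
  -- call-by-name application rules (A)
  | appAdd (M N L : Term R) : StepA (app (add M N) L) (add (app M L) (app N L))
  | appSmul (a : R) (M N : Term R) : StepA (app (smul a M) N) (smul a (app M N))
  | appZero (M : Term R) : StepA (app zero M) zero
  -- ξ context rules
  | ctxAppL {M M' : Term R} (N : Term R) : StepA M M' → StepA (app M N) (app M' N)
  | ctxAddL {M M' : Term R} (N : Term R) : StepA M M' → StepA (add M N) (add M' N)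
  | ctxAddR {N N' : Term R} (M : Term R) : StepA N N' → StepA (add M N) (add M N')
  | ctxSmul (a : R) {M M' : Term R} : StepA M M' → StepA (smul a M) (smul a M')

/-- The call-by-name β-reduction `→βn`, closed under the ξ contexts. -/
inductive StepBn : Term R → Term R → Prop
  | beta (M N : Term R) : StepBn (app (lam M) N) (subst 0 N M)
  | ctxAppL {M M' : Term R} (N : Term R) : StepBn M M' → StepBn (app M N) (app M' N)
  | ctxAddL {M M' : Term R} (N : Term R) : StepBn M M' → StepBn (add M N) (add M' N)
  | ctxAddR {N N' : Term R} (M : Term R) : StepBn N N' → StepBn (add M N) (add M N')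
  | ctxSmul (a : R) {M M' : Term R} : StepBn M M' → StepBn (smul a M) (smul a M')

/-- The rewrite relation `→a∪β`. -/
def StepAB (M N : Term R) : Prop := StepA M N ∨ StepBn M N

/-- The rewrite relation `→ℓ` of the call-by-value algebraic λ-calculus:
    ring rules, left- and right-linearity rules, closed under ξ and ξ_lin. -/
inductive StepL : Term R → Term R → Prop
  -- ring rules
  | assocL (M N L : Term R) : StepL (add M (add N L)) (add (add M N) L)
  | assocR (M N L : Term R) : StepL (add (add M N) L) (add M (add N L))
  | comm (M N : Term R) : StepL (add M N) (add N M)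
  | factor (a b : R) (M : Term R) : StepL (add (smul a M) (smul b M)) (smul (a + b) M)
  | factor1 (a : R) (M : Term R) : StepL (add (smul a M) M) (smul (a + 1) M)
  | factor11 (M : Term R) : StepL (add M M) (smul (1 + 1) M)
  | mulMul (a b : R) (M : Term R) : StepL (smul a (smul b M)) (smul (a * b) M)
  | mulDist (a : R) (M N : Term R) : StepL (smul a (add M N)) (add (smul a M) (smul a N))
  | oneSmul (M : Term R) : StepL (smul 1 M) M
  | zeroSmul (M : Term R) : StepL (smul 0 M) zero
  | smulZero (a : R) : StepL (smul a zero) zero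
  | zeroAdd (M : Term R) : StepL (add zero M) M
  -- left linearity (A_l), the argument must be a value
  | appAddV {V : Term R} (M N : Term R) : IsValue V →
      StepL (app (add M N) V) (add (app M V) (app N V))
  | appSmulV {V : Term R} (a : R) (M : Term R) : IsValue V →
      StepL (app (smul a M) V) (smul a (app M V))
  | appZeroV {V : Term R} : IsValue V → StepL (app zero V) zero
  -- right linearity (A_r), the function must be a base term
  | appAddB {B : Term R} (M N : Term R) : IsBase B →
      StepL (app B (add M N)) (add (app B M) (app B N))
  | appSmulB {B : Term R} (a : R) (M : Term R) : IsBase B →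
      StepL (app B (smul a M)) (smul a (app B M))
  | appZeroB {B : Term R} : IsBase B → StepL (app B zero) zero
  -- ξ context rules
  | ctxAppL {M M' : Term R} (N : Term R) : StepL M M' → StepL (app M N) (app M' N)
  | ctxAddL {M M' : Term R} (N : Term R) : StepL M M' → StepL (add M N) (add M' N)
  | ctxAddR {N N' : Term R} (M : Term R) : StepL N N' → StepL (add M N) (add M N')
  | ctxSmul (a : R) {M M' : Term R} : StepL M M' → StepL (smul a M) (smul a M')
  -- ξ_lin context rule
  | ctxAppR {V M M' : Term R} : IsValue V → StepL M M' → StepL (app V M) (app V M')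

/-- The call-by-value β-reduction `→βv`, closed under ξ and ξ_lin. -/
inductive StepBv : Term R → Term R → Prop
  | beta (M : Term R) {B : Term R} : IsBase B → StepBv (app (lam M) B) (subst 0 B M)
  | ctxAppL {M M' : Term R} (N : Term R) : StepBv M M' → StepBv (app M N) (app M' N)
  | ctxAddL {M M' : Term R} (N : Term R) : StepBv M M' → StepBv (add M N) (add M' N)
  | ctxAddR {N N' : Term R} (M : Term R) : StepBv N N' → StepBv (add M N) (add M N')
  | ctxSmul (a : R) {M M' : Term R} : StepBv M M' → StepBv (smul a M) (smul a M')
  | ctxAppR {V M M' : Term R} : IsValue V → StepBv M M' → StepBv (app V M) (app V M')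

/-- The rewrite relation `→ℓ∪β`. -/
def StepLB (M N : Term R) : Prop := StepL M N ∨ StepBv M N

end Rules

/-- Steps of `→a` performed by an associativity or commutativity rule
    (closed under the ξ contexts). -/
inductive StepACa : Term R → Term R → Prop
  | assocL (M N L : Term R) : StepACa (add M (add N L)) (add (add M N) L)
  | assocR (M N L : Term R) : StepACa (add (add M N) L) (add M (add N L))
  | comm (M N : Term R) : StepACa (add M N) (add N M)
  | ctxAppL {M M' : Term R} (N : Term R) : StepACa M M' → StepACa (app M N) (app M' N)
  | ctxAddL {M M' : Term R} (N : Term R) : StepACa M M' → StepACa (add M N) (add M' N)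
  | ctxAddR {N N' : Term R} (M : Term R) : StepACa N N' → StepACa (add M N) (add M N')
  | ctxSmul (a : R) {M M' : Term R} : StepACa M M' → StepACa (smul a M) (smul a M')

/-- Steps of `→ℓ` performed by an associativity or commutativity rule
    (closed under the ξ and ξ_lin contexts). -/
inductive StepACl : Term R → Term R → Prop
  | assocL (M N L : Term R) : StepACl (add M (add N L)) (add (add M N) L)
  | assocR (M N L : Term R) : StepACl (add (add M N) L) (add M (add N L))
  | comm (M N : Term R) : StepACl (add M N) (add N M)
  | ctxAppL {M M' : Term R} (N : Term R) : StepACl M M' → StepACl (app M N) (app M' N)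
  | ctxAddL {M M' : Term R} (N : Term R) : StepACl M M' → StepACl (add M N) (add M' N)
  | ctxAddR {N N' : Term R} (M : Term R) : StepACl N N' → StepACl (add M N) (add M N')
  | ctxSmul (a : R) {M M' : Term R} : StepACl M M' → StepACl (smul a M) (smul a M')
  | ctxAppR {V M M' : Term R} : IsValue V → StepACl M M' → StepACl (app V M) (app V M')

section NonAC

variable [CommRing R]

/-- Steps of `→a` performed by a rule other than associativity or commutativity of `+`
    (closed under the ξ contexts). -/
inductive StepNAa : Term R → Term R → Prop
  | factor (a b : R) (M : Term R) : StepNAa (add (smul a M) (smul b M)) (smul (a + b) M)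
  | factor1 (a : R) (M : Term R) : StepNAa (add (smul a M) M) (smul (a + 1) M)
  | factor11 (M : Term R) : StepNAa (add M M) (smul (1 + 1) M)
  | mulMul (a b : R) (M : Term R) : StepNAa (smul a (smul b M)) (smul (a * b) M)
  | mulDist (a : R) (M N : Term R) : StepNAa (smul a (add M N)) (add (smul a M) (smul a N))
  | oneSmul (M : Term R) : StepNAa (smul 1 M) M
  | zeroSmul (M : Term R) : StepNAa (smul 0 M) zero
  | smulZero (a : R) : StepNAa (smul a zero) zero
  | zeroAdd (M : Term R) : StepNAa (add zero M) M
  | appAdd (M N L : Term R) : StepNAa (app (add M N) L) (add (app M L) (app N L))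
  | appSmul (a : R) (M N : Term R) : StepNAa (app (smul a M) N) (smul a (app M N))
  | appZero (M : Term R) : StepNAa (app zero M) zero
  | ctxAppL {M M' : Term R} (N : Term R) : StepNAa M M' → StepNAa (app M N) (app M' N)
  | ctxAddL {M M' : Term R} (N : Term R) : StepNAa M M' → StepNAa (add M N) (add M' N)
  | ctxAddR {N N' : Term R} (M : Term R) : StepNAa N N' → StepNAa (add M N) (add M N')
  | ctxSmul (a : R) {M M' : Term R} : StepNAa M M' → StepNAa (smul a M) (smul a M')

/-- Steps of `→ℓ` performed by a rule other than associativity or commutativity of `+`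
    (closed under the ξ and ξ_lin contexts). -/
inductive StepNAl : Term R → Term R → Prop
  | factor (a b : R) (M : Term R) : StepNAl (add (smul a M) (smul b M)) (smul (a + b) M)
  | factor1 (a : R) (M : Term R) : StepNAl (add (smul a M) M) (smul (a + 1) M)
  | factor11 (M : Term R) : StepNAl (add M M) (smul (1 + 1) M)
  | mulMul (a b : R) (M : Term R) : StepNAl (smul a (smul b M)) (smul (a * b) M)
  | mulDist (a : R) (M N : Term R) : StepNAl (smul a (add M N)) (add (smul a M) (smul a N))
  | oneSmul (M : Term R) : StepNAl (smul 1 M) M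
  | zeroSmul (M : Term R) : StepNAl (smul 0 M) zero
  | smulZero (a : R) : StepNAl (smul a zero) zero
  | zeroAdd (M : Term R) : StepNAl (add zero M) M
  | appAddV {V : Term R} (M N : Term R) : IsValue V →
      StepNAl (app (add M N) V) (add (app M V) (app N V))
  | appSmulV {V : Term R} (a : R) (M : Term R) : IsValue V →
      StepNAl (app (smul a M) V) (smul a (app M V))
  | appZeroV {V : Term R} : IsValue V → StepNAl (app zero V) zero
  | appAddB {B : Term R} (M N : Term R) : IsBase B →
      StepNAl (app B (add M N)) (add (app B M) (app B N))
  | appSmulB {B : Term R} (a : R) (M : Term R) : IsBase B →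
      StepNAl (app B (smul a M)) (smul a (app B M))
  | appZeroB {B : Term R} : IsBase B → StepNAl (app B zero) zero
  | ctxAppL {M M' : Term R} (N : Term R) : StepNAl M M' → StepNAl (app M N) (app M' N)
  | ctxAddL {M M' : Term R} (N : Term R) : StepNAl M M' → StepNAl (add M N) (add M' N)
  | ctxAddR {N N' : Term R} (M : Term R) : StepNAl N N' → StepNAl (add M N) (add M N')
  | ctxSmul (a : R) {M M' : Term R} : StepNAl M M' → StepNAl (smul a M) (smul a M')
  | ctxAppR {V M M' : Term R} : IsValue V → StepNAl M M' → StepNAl (app V M) (app V M')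

end NonAC

/-- The call-by-value-to-call-by-name encoding `M ↦ M~`.
    The fresh variables `f`, `g`, `h` are handled by de Bruijn lifting. -/
def cbvEnc : Term R → Term R
  | var n => lam (app (var 0) (var (n + 1)))
  | zero => zero
  | lam M => lam (app (var 0) (lift 0 (lam (cbvEnc M))))
  | app M N =>
      lam (app (lift 0 (cbvEnc M))
        (lam (app (lift 0 (lift 0 (cbvEnc N)))
          (lam (app (app (var 1) (var 0)) (var 2))))))
  | smul a M => lam (app (smul a (lift 0 (cbvEnc M))) (var 0))
  | add M N => lam (app (add (lift 0 (cbvEnc M)) (lift 0 (cbvEnc N))) (var 0))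

/-- The value encoding `Ψ` (its value on non-values is irrelevant). -/
def psi : Term R → Term R
  | var n => var n
  | zero => zero
  | lam M => lam (cbvEnc M)
  | smul a V => smul a (psi V)
  | add V W => add (psi V) (psi W)
  | app M N => app (psi M) (psi N)

/-- The call-by-name-to-call-by-value encoding `M ↦ ⟦M⟧`. -/
def cbnEnc : Term R → Term R
  | var n => var n
  | zero => lam (app zero (var 0))
  | lam M => lam (app (var 0) (lift 0 (lam (cbnEnc M))))
  | app M N =>
      lam (app (lift 0 (cbnEnc M))
        (lam (app (app (var 0) (lift 0 (lift 0 (cbnEnc N)))) (var 1))))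
  | smul a M => lam (app (smul a (lift 0 (cbnEnc M))) (var 0))
  | add M N => lam (app (add (lift 0 (cbnEnc M)) (lift 0 (cbnEnc N))) (var 0))

/-- The value encoding `Φ` (its value on non-values is irrelevant). -/
def phi : Term R → Term R
  | var n => app (var n) (lam (var 0))
  | zero => zero
  | lam M => lam (cbnEnc M)
  | smul a V => smul a (phi V)
  | add V W => add (phi V) (phi W)
  | app M N => app (phi M) (phi N)

/-- A measure on terms used to define the administrative operation `(:)`. -/
def size : Term R → ℕ
  | var _ => 1
  | lam _ => 1
  | zero => 1
  | smul _ M => 1 + size M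
  | add M N => 1 + size M + size N
  | app M N => size M * (size N + 1)

theorem size_pos : ∀ M : Term R, 0 < size M
  | var _ => Nat.one_pos
  | lam _ => Nat.one_pos
  | zero => Nat.one_pos
  | smul _ M => by simp [size]
  | add M N => by simp [size]
  | app M N => Nat.mul_pos (size_pos M) (Nat.succ_pos _)

/-- The administrative infix operation `(:)` of the call-by-value to call-by-name
    simulation: `colon M K` is `M : K`. -/
def colon : Term R → Term R → Term R
  | zero, _ => zero
  | var n, K => app K (var n)
  | lam M, K => app K (lam (cbvEnc M))
  | smul a M, K => smul a (colon M K)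
  | add M N, K => add (colon M K) (colon N K)
  | app zero _, _ => zero
  | app (var n) N, K =>
      colon N (lam (app (app (var (n + 1)) (var 0)) (lift 0 K)))
  | app (lam M) N, K =>
      colon N (lam (app (app (lift 0 (lam (cbvEnc M))) (var 0)) (lift 0 K)))
  | app (smul a M) N, K => smul a (colon (app M N) K)
  | app (add M M') N, K => add (colon (app M N) K) (colon (app M' N) K)
  | app (app M M') L, K =>
      colon (app M M')
        (lam (app (lift 0 (cbvEnc L))
          (lam (app (app (var 1) (var 0)) (lift 0 (lift 0 K))))))
termination_by M _ => size M
decreasing_by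
  all_goals simp only [size]
  · omega
  · omega
  · omega
  · nlinarith [size_pos N]
  · nlinarith [size_pos N]
  · nlinarith [size_pos M, size_pos N]
  · nlinarith [size_pos M, size_pos M', size_pos N]
  · nlinarith [size_pos M, size_pos M', size_pos N]
  · nlinarith [size_pos L, Nat.mul_pos (size_pos M) (Nat.succ_pos (size M'))]



section Equalities

variable [CommRing R]

/-- The restricted algebraic equality `=ℓ^F` on a fragment `F`. -/
def EqL (F : Set (Term R)) (M N : Term R) : Prop :=
  M ∈ F ∧ N ∈ F ∧ (StepL M N ∨ StepL N M)

/-- The relation `=ℓ∪β^F` : restricted algebraic equality together with `→βv` restricted to `F`. -/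
def EqLB (F : Set (Term R)) (M N : Term R) : Prop :=
  EqL F M N ∨ (M ∈ F ∧ N ∈ F ∧ StepBv M N)

/-- The restricted algebraic equality `=a^F` on a fragment `F`. -/
def EqA (F : Set (Term R)) (M N : Term R) : Prop :=
  M ∈ F ∧ N ∈ F ∧ (StepA M N ∨ StepA N M)

/-- The relation `=a∪β^F` : restricted algebraic equality together with `→βn` restricted to `F`. -/
def EqAB (F : Set (Term R)) (M N : Term R) : Prop :=
  EqA F M N ∨ (M ∈ F ∧ N ∈ F ∧ StepBn M N)

/-- The unrestricted algebraic equality `=ℓ` (symmetric closure of `→ℓ`). -/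
def EqLfull (M N : Term R) : Prop := StepL M N ∨ StepL N M

/-- The unrestricted relation `=ℓ∪β`. -/
def EqLBfull (M N : Term R) : Prop := EqLfull M N ∨ StepBv M N

/-- The unrestricted algebraic equality `=a` (symmetric closure of `→a`). -/
def EqAfull (M N : Term R) : Prop := StepA M N ∨ StepA N M

/-- The unrestricted relation `=a∪β`. -/
def EqABfull (M N : Term R) : Prop := EqAfull M N ∨ StepBn M N

end Equalities

section Substitution

theorem lift_lift (M : Term R) {i j : ℕ} (h : i ≤ j) :
    lift i (lift j M) = lift (j + 1) (lift i M) := by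
  induction M generalizing i j with
  | var n => simp only [lift]; grind [lift]
  | lam M ih => simp only [lift, ih (Nat.succ_le_succ h)]
  | app M N ihM ihN => simp only [lift, ihM h, ihN h]
  | zero => rfl
  | smul a M ih => simp only [lift, ih h]
  | add M N ihM ihN => simp only [lift, ihM h, ihN h]

theorem lift_zero_lift (d : ℕ) (M : Term R) :
    lift (d + 1) (lift 0 M) = lift 0 (lift d M) :=
  (lift_lift M (Nat.zero_le d)).symm

theorem subst_lift (d : ℕ) (N M : Term R) : subst d N (lift d M) = M := by
  induction M generalizing d N with
  | var n => simp only [lift]; grind [subst]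
  | lam M ih => simp only [lift, subst, ih]
  | app M N ihM ihN => simp only [lift, subst, ihM, ihN]
  | zero => rfl
  | smul a M ih => simp only [lift, subst, ih]
  | add M N ihM ihN => simp only [lift, subst, ihM, ihN]

theorem subst_lift_of_le (N M : Term R) {i d : ℕ} (h : i ≤ d) :
    subst (d + 1) (lift i N) (lift i M) = lift i (subst d N M) := by
  induction M generalizing i d N with
  | var n => simp only [lift, subst]; grind [lift, subst]
  | lam M ih =>
    simp only [lift, subst, lift_lift N (Nat.zero_le i), ih _ (Nat.succ_le_succ h)]
  | app M N ihM ihN => simp only [lift, subst, ihM _ h, ihN _ h]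
  | zero => rfl
  | smul a M ih => simp only [lift, subst, ih _ h]
  | add M N ihM ihN => simp only [lift, subst, ihM _ h, ihN _ h]

theorem subst_succ_lift_zero (d : ℕ) (N M : Term R) :
    subst (d + 1) (lift 0 N) (lift 0 M) = lift 0 (subst d N M) :=
  subst_lift_of_le N M (Nat.zero_le d)

theorem cbvEnc_lift (d : ℕ) (M : Term R) : cbvEnc (lift d M) = lift d (cbvEnc M) := by
  induction M generalizing d with
  | var n => simp only [lift]; grind [lift, cbvEnc]
  | lam M ih =>
    simp only [lift, cbvEnc, ih, lift_lift _ (Nat.succ_le_succ (Nat.zero_le d))]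
    simp
  | app M N ihM ihN => simp [lift, cbvEnc, ihM, ihN, lift_zero_lift]
  | zero => rfl
  | smul a M ih => simp [lift, cbvEnc, ih, lift_zero_lift]
  | add M N ihM ihN => simp [lift, cbvEnc, ihM, ihN, lift_zero_lift]

theorem IsBase.lift {B : Term R} (hB : IsBase B) (d : ℕ) : IsBase (lift d B) := by
  cases hB with
  | var n => simp only [Term.lift]; split <;> exact .var _
  | lam M => exact .lam _

theorem IsBase.psi_lift {B : Term R} (hB : IsBase B) (d : ℕ) :
    psi (Term.lift d B) = Term.lift d (psi B) := by
  cases hB with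
  | var n => simp only [Term.lift, psi]; split <;> rfl
  | lam M => simp only [Term.lift, psi, cbvEnc_lift]

theorem IsBase.cbvEnc_eq {B : Term R} (hB : IsBase B) :
    cbvEnc B = Term.lam (app (Term.var 0) (Term.lift 0 (psi B))) := by
  cases hB <;> rfl

theorem IsBase.cbvEnc_subst {B : Term R} (hB : IsBase B) (d : ℕ) (M : Term R) :
    cbvEnc (subst d B M) = subst d (psi B) (cbvEnc M) := by
  induction M generalizing d B with
  | var n =>
    simp only [subst, cbvEnc]
    rcases lt_trichotomy n d with h | rfl | h
    · simp [h, cbvEnc]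
    · simp [hB.cbvEnc_eq]
    · obtain ⟨n, rfl⟩ : ∃ k, n = k + 1 := ⟨n - 1, by omega⟩
      have h1 : ¬ n + 1 < d := by omega
      have h2 : n + 1 ≠ d := by omega
      simp [h1, h2, cbvEnc]
  | lam M ih =>
    have h := subst_succ_lift_zero d (psi B) (Term.lam (cbvEnc M))
    simp only [subst, cbvEnc, ih (hB.lift 0), hB.psi_lift] at h ⊢
    rw [h]
    simp
  | app M N ihM ihN => simp [subst, cbvEnc, ihM hB, ihN hB, subst_succ_lift_zero]
  | zero => rfl
  | smul a M ih => simp [subst, cbvEnc, ih hB, subst_succ_lift_zero]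
  | add M N ihM ihN => simp [subst, cbvEnc, ihM hB, ihN hB, subst_succ_lift_zero]

end Substitution

section Colon

open Relation

/-- The continuation that receives the value of a function, then evaluates the argument `N`. -/
def funCont (N K : Term R) : Term R :=
  lam (app (lift 0 (cbvEnc N)) (lam (app (app (var 1) (var 0)) (lift 0 (lift 0 K)))))

/-- The continuation that receives the value of an argument of the function value `P`. -/
def argCont (P K : Term R) : Term R :=
  lam (app (app (lift 0 P) (var 0)) (lift 0 K))

theorem colon_zero (K : Term R) : colon zero K = zero := by rw [colon]

theorem IsBase.colon {B : Term R} (hB : IsBase B) (K : Term R) :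
    colon B K = app K (psi B) := by
  cases hB <;> rw [Term.colon] <;> rfl

theorem colon_smul (a : R) (M K : Term R) : colon (smul a M) K = smul a (colon M K) := by
  rw [colon]

theorem colon_add (M N K : Term R) : colon (add M N) K = add (colon M K) (colon N K) := by
  rw [colon]

theorem colon_app_zero (N K : Term R) : colon (app zero N) K = zero := by rw [colon]

theorem IsBase.colon_app {B : Term R} (hB : IsBase B) (N K : Term R) :
    Term.colon (app B N) K = Term.colon N (argCont (psi B) K) := by
  cases hB <;> rw [Term.colon] <;> rfl

theorem colon_app_smul (a : R) (M N K : Term R) :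
    colon (app (smul a M) N) K = smul a (colon (app M N) K) := by rw [colon]

theorem colon_app_add (M M' N K : Term R) :
    colon (app (add M M') N) K = add (colon (app M N) K) (colon (app M' N) K) := by
  rw [colon]

theorem colon_app_app (M M' N K : Term R) :
    colon (app (app M M') N) K = colon (app M M') (funCont N K) := by
  rw [colon, funCont]

/-- Simulation of reductions in the argument of a value. -/
theorem IsValue.colon_app_congr {r : Term R → Term R → Prop} {V N N' : Term R}
    (hV : IsValue V)
    (hadd : ∀ {M M' L L'}, ReflTransGen r M M' → ReflTransGen r L L' →
      ReflTransGen r (Term.add M L) (Term.add M' L'))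
    (hsmul : ∀ a {M M'}, ReflTransGen r M M' →
      ReflTransGen r (Term.smul a M) (Term.smul a M'))
    (h : ∀ K, ReflTransGen r (colon N K) (colon N' K)) (K : Term R) :
    ReflTransGen r (colon (app V N) K) (colon (app V N') K) := by
  induction hV with
  | zero => rw [colon_app_zero, colon_app_zero]
  | base hB => rw [hB.colon_app, hB.colon_app]; exact h _
  | smul a _ ih => rw [colon_app_smul, colon_app_smul]; exact hsmul a ih
  | add _ _ ihV ihW => rw [colon_app_add, colon_app_add]; exact hadd ihV ihW

end Colon

section Simulation

open Relation

variable [CommRing R]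

theorem StepA.reflTransGen_add {M M' N N' : Term R} (hM : ReflTransGen StepA M M')
    (hN : ReflTransGen StepA N N') : ReflTransGen StepA (add M N) (add M' N') :=
  (hM.lift (add · N) fun _ _ => StepA.ctxAddL N).trans
    (hN.lift (add M') fun _ _ => StepA.ctxAddR M')

theorem StepA.reflTransGen_smul (a : R) {M M' : Term R} (hM : ReflTransGen StepA M M') :
    ReflTransGen StepA (smul a M) (smul a M') :=
  hM.lift (smul a) fun _ _ => StepA.ctxSmul a

theorem StepAB.reflTransGen_add {M M' N N' : Term R} (hM : ReflTransGen StepAB M M')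
    (hN : ReflTransGen StepAB N N') : ReflTransGen StepAB (add M N) (add M' N') :=
  (hM.lift (add · N) fun _ _ => Or.imp (StepA.ctxAddL N) (StepBn.ctxAddL N)).trans
    (hN.lift (add M') fun _ _ => Or.imp (StepA.ctxAddR M') (StepBn.ctxAddR M'))

theorem StepAB.reflTransGen_smul (a : R) {M M' : Term R} (hM : ReflTransGen StepAB M M') :
    ReflTransGen StepAB (smul a M) (smul a M') :=
  hM.lift (smul a) fun _ _ => Or.imp (StepA.ctxSmul a) (StepBn.ctxSmul a)

theorem StepAB.beta {M N L : Term R} (h : subst 0 N M = L) : StepAB (app (lam M) N) L :=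
  h ▸ Or.inr (StepBn.beta M N)

theorem StepAB.funCont_beta (N K P : Term R) :
    StepAB (app (funCont N K) P) (app (cbvEnc N) (argCont P K)) :=
  StepAB.beta (by simp [subst, subst_lift, subst_succ_lift_zero, argCont])

theorem StepAB.argCont_beta (P K Q : Term R) :
    StepAB (app (argCont P K) Q) (app (app P Q) K) :=
  StepAB.beta (by simp [subst, subst_lift])

/-- Evaluating a function and passing it to `funCont N K` simulates the application to `N`,
provided that the encoding of `N` reduces to the administrative normal form of `N`. -/
theorem colon_funCont_reduces {N : Term R}
    (hN : ∀ K, ReflTransGen StepAB (app (cbvEnc N) K) (colon N K)) (P K : Term R) :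
    ReflTransGen StepAB (colon P (funCont N K)) (colon (app P N) K) := by
  have base {B : Term R} (hB : IsBase B) :
      ReflTransGen StepAB (colon B (funCont N K)) (colon (app B N) K) := by
    rw [hB.colon, hB.colon_app]
    exact .head (StepAB.funCont_beta N K _) (hN _)
  induction P with
  | var n => exact base (.var n)
  | lam M => exact base (.lam M)
  | app M M' => rw [colon_app_app]
  | zero => rw [colon_zero, colon_app_zero]
  | smul a M ih => rw [colon_smul, colon_app_smul]; exact StepAB.reflTransGen_smul a ih
  | add M M' ihM ihM' =>
    rw [colon_add, colon_app_add]; exact StepAB.reflTransGen_add ihM ihM'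

theorem IsBase.cbvEnc_app_reduces_colon {B : Term R} (hB : IsBase B) (K : Term R) :
    ReflTransGen StepAB (app (cbvEnc B) K) (Term.colon B K) := by
  rw [hB.colon, hB.cbvEnc_eq]
  exact .single (StepAB.beta (by simp [subst, subst_lift]))

theorem cbvEnc_app_reduces_colon (M K : Term R) :
    ReflTransGen StepAB (app (cbvEnc M) K) (colon M K) := by
  induction M generalizing K with
  | var n => exact IsBase.cbvEnc_app_reduces_colon (.var n) K
  | lam M => exact IsBase.cbvEnc_app_reduces_colon (.lam M) K
  | app M N ihM ihN =>
    refine .head (b := app (cbvEnc M) (funCont N K)) (StepAB.beta ?_)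
      ((ihM _).trans (colon_funCont_reduces ihN M K))
    simp [subst, subst_lift, subst_succ_lift_zero, funCont]
  | zero => rw [colon_zero]; exact .single (.inl (.appZero K))
  | smul a M ih =>
    rw [colon_smul]
    refine .head (b := app (smul a (cbvEnc M)) K) (StepAB.beta ?_)
      (.head (.inl (.appSmul a _ K)) (StepAB.reflTransGen_smul a (ih K)))
    simp [subst, subst_lift]
  | add M N ihM ihN =>
    rw [colon_add]
    refine .head (b := app (add (cbvEnc M) (cbvEnc N)) K) (StepAB.beta ?_)
      (.head (.inl (.appAdd _ _ K)) (StepAB.reflTransGen_add (ihM K) (ihN K)))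
    simp [subst, subst_lift]

/-- A step of `→ℓ` is simulated by `→a` under every continuation, at the root as well as in
function position. -/
theorem StepL.colon_reduces {M M' : Term R} (h : StepL M M') :
    (∀ K, ReflTransGen StepA (colon M K) (colon M' K)) ∧
    ∀ L K, ReflTransGen StepA (colon (app M L) K) (colon (app M' L) K) := by
  induction h with
  | appAddV M N _ =>
    simp only [colon_app_app, colon_app_add, colon_add]
    exact ⟨fun _ => .refl, fun _ _ => .refl⟩
  | appSmulV a M _ =>
    simp only [colon_app_app, colon_app_smul, colon_smul]
    exact ⟨fun _ => .refl, fun _ _ => .refl⟩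
  | appZeroV _ =>
    simp only [colon_app_app, colon_app_zero, colon_zero]
    exact ⟨fun _ => .refl, fun _ _ => .refl⟩
  | appAddB M N hB =>
    simp only [colon_app_app, colon_app_add, hB.colon_app, colon_add]
    exact ⟨fun _ => .refl, fun _ _ => .refl⟩
  | appSmulB a M hB =>
    simp only [colon_app_app, colon_app_smul, hB.colon_app, colon_smul]
    exact ⟨fun _ => .refl, fun _ _ => .refl⟩
  | appZeroB hB =>
    simp only [colon_app_app, colon_app_zero, hB.colon_app, colon_zero]
    exact ⟨fun _ => .refl, fun _ _ => .refl⟩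
  | ctxAppL N _ ih =>
    simp only [colon_app_app]
    exact ⟨ih.2 N, fun L K => ih.2 N _⟩
  | ctxAddL N _ ih =>
    simp only [colon_add, colon_app_add]
    exact ⟨fun K => StepA.reflTransGen_add (ih.1 K) .refl,
      fun L K => StepA.reflTransGen_add (ih.2 L K) .refl⟩
  | ctxAddR M _ ih =>
    simp only [colon_add, colon_app_add]
    exact ⟨fun K => StepA.reflTransGen_add .refl (ih.1 K),
      fun L K => StepA.reflTransGen_add .refl (ih.2 L K)⟩
  | ctxSmul a _ ih =>
    simp only [colon_smul, colon_app_smul]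
    exact ⟨fun K => StepA.reflTransGen_smul a (ih.1 K),
      fun L K => StepA.reflTransGen_smul a (ih.2 L K)⟩
  | ctxAppR hV _ ih =>
    simp only [colon_app_app]
    have key := hV.colon_app_congr StepA.reflTransGen_add StepA.reflTransGen_smul ih.1
    exact ⟨key, fun L K => key _⟩
  | _ =>
    simp only [colon_add, colon_smul, colon_zero, colon_app_add, colon_app_smul, colon_app_zero]
    exact ⟨fun _ => .single (by constructor), fun _ _ => .single (by constructor)⟩

/-- A step of `→βv` is simulated by `→a∪β` under every continuation, at the root as well as in
function position. -/
theorem StepBv.colon_reduces {M M' : Term R} (h : StepBv M M') :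
    (∀ K, ReflTransGen StepAB (colon M K) (colon M' K)) ∧
    ∀ L K, ReflTransGen StepAB (colon (app M L) K) (colon (app M' L) K) := by
  induction h with
  | @beta M B hB =>
    have key (K) : ReflTransGen StepAB (colon (app (lam M) B) K) (colon (subst 0 B M) K) := by
      rw [(IsBase.lam M).colon_app, hB.colon]
      refine .head (StepAB.argCont_beta _ K _) (.head (b := app (cbvEnc (subst 0 B M)) K) ?_
        (cbvEnc_app_reduces_colon _ K))
      rw [hB.cbvEnc_subst]
      exact .inr (.ctxAppL K (.beta _ _))
    refine ⟨key, fun L K => ?_⟩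
    rw [colon_app_app]
    exact (key _).trans (colon_funCont_reduces (cbvEnc_app_reduces_colon L) _ K)
  | ctxAppL N _ ih =>
    simp only [colon_app_app]
    exact ⟨ih.2 N, fun L K => ih.2 N _⟩
  | ctxAddL N _ ih =>
    simp only [colon_add, colon_app_add]
    exact ⟨fun K => StepAB.reflTransGen_add (ih.1 K) .refl,
      fun L K => StepAB.reflTransGen_add (ih.2 L K) .refl⟩
  | ctxAddR M _ ih =>
    simp only [colon_add, colon_app_add]
    exact ⟨fun K => StepAB.reflTransGen_add .refl (ih.1 K),
      fun L K => StepAB.reflTransGen_add .refl (ih.2 L K)⟩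
  | ctxSmul a _ ih =>
    simp only [colon_smul, colon_app_smul]
    exact ⟨fun K => StepAB.reflTransGen_smul a (ih.1 K),
      fun L K => StepAB.reflTransGen_smul a (ih.2 L K)⟩
  | ctxAppR hV _ ih =>
    simp only [colon_app_app]
    have key := hV.colon_app_congr StepAB.reflTransGen_add StepAB.reflTransGen_smul ih.1
    exact ⟨key, fun L K => key _⟩

theorem IsValue.colon_id_reduces {V : Term R} (hV : IsValue V) :
    ReflTransGen StepAB (colon V (lam (var 0))) (psi V) := by
  induction hV with
  | zero => rw [colon_zero]; exact .refl
  | base hB => rw [hB.colon]; exact .single (StepAB.beta (by simp [subst]))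
  | smul a _ ih => rw [colon_smul]; exact StepAB.reflTransGen_smul a ih
  | add _ _ ihV ihW => rw [colon_add]; exact StepAB.reflTransGen_add ihV ihW

/-- Reductions that start in a call-by-name fragment stay in it. -/
theorem StepAB.reflTransGen_fragment {F : Set (Term R)}
    (hF : ∀ M ∈ F, ∀ N, StepAB M N → N ∈ F) {M N : Term R} (hM : M ∈ F)
    (h : ReflTransGen StepAB M N) : N ∈ F ∧ ReflTransGen (EqAB F) M N := by
  induction h with
  | refl => exact ⟨hM, .refl⟩
  | tail _ hstep ih =>
    have hmem := hF _ ih.1 _ hstep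
    exact ⟨hmem, ih.2.tail (hstep.imp (fun h => ⟨ih.1, hmem, .inl h⟩) fun h => ⟨ih.1, hmem, h⟩)⟩

theorem StepA.reflTransGen_fragment_symm {F : Set (Term R)}
    (hF : ∀ M ∈ F, ∀ N, StepAB M N → N ∈ F) {M N : Term R} (hM : M ∈ F)
    (h : ReflTransGen StepA M N) : ReflTransGen (EqAB F) N M := by
  induction h using ReflTransGen.head_induction_on with
  | refl => exact .refl
  | head hstep _ ih =>
    have hmem := hF _ hM _ (.inl hstep)
    exact (ih hmem).tail (.inl ⟨hmem, hM, .inr hstep⟩)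

end Simulation

section Statements

variable [CommRing R]

/-- simulation of call-by-value algebraic equality by call-by-name
algebraic equality, relative to fragments `Sl` and `Sa` with
`(M~) λx.x ∈ Sa` for all `M ∈ Sl`. -/
theorem simulation_cbv_eq_by_cbn_eq (Sl Sa : Set (Term R))
    (hSl : ∀ M ∈ Sl, ∀ N, StepLB M N → N ∈ Sl)
    (hSa : ∀ M ∈ Sa, ∀ N, StepAB M N → N ∈ Sa)
    (henc : ∀ M ∈ Sl, app (cbvEnc M) (lam (var 0)) ∈ Sa)
    (M V : Term R) (hM : M ∈ Sl) (hV : IsValue V)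
    (h : Relation.ReflTransGen (EqLB Sl) M V) :
    Relation.ReflTransGen (EqAB Sa) (app (cbvEnc M) (lam (var 0))) (psi V) := by
  have hcolon {N} (hN : N ∈ Sl) :=
    StepAB.reflTransGen_fragment hSa (henc N hN) (cbvEnc_app_reduces_colon N _)
  have hsim : Relation.ReflTransGen (EqAB Sa)
      (app (cbvEnc M) (lam (var 0))) (colon V (lam (var 0))) := by
    clear hV
    induction h with
    | refl => exact (hcolon hM).2
    | tail _ hstep ih =>
      refine ih.trans ?_
      rcases hstep with ⟨hN, hN', hstep | hstep⟩ | ⟨hN, _, hstep⟩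
      · have hAB := Relation.ReflTransGen.mono (p := StepAB) (fun _ _ => Or.inl) _ _
          (hstep.colon_reduces.1 (lam (var 0)))
        exact (StepAB.reflTransGen_fragment hSa (hcolon hN).1 hAB).2
      · exact StepA.reflTransGen_fragment_symm hSa (hcolon hN').1 (hstep.colon_reduces.1 _)
      · exact (StepAB.reflTransGen_fragment hSa (hcolon hN).1 (hstep.colon_reduces.1 _)).2
  have hVS : V ∈ Sl := by
    cases h with
    | refl => exact hM
    | tail _ hstep => exact hstep.elim (·.2.1) (·.2.1)
  exact hsim.trans (StepAB.reflTransGen_fragment hSa (hcolon hVS).1 hV.colon_id_reduces).2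

end Statements

end Term

end AlgLam
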